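/- There exist constants δ₀ > 0, K > 0, c > 0 and C > 0 such that for every δ with 0 < δ < δ₀ the following holds. If φ ∈ ℓ²(ℤ×ℤ;ℂ) with ‖φ‖₂ = 1 is an eigenfunction of the Floquet Hamiltonian H with eigenvalue E ∈ ℝ, then either (i) |φ(j,n)| ≤ C·exp(−(|j| + |n − ⌊E⌋|)/K) for all (j,n) ∈ ℤ×ℤ, where ⌊E⌋ is the integer part of E; or (ii) there exist points x₁ = (j₁,n₁) and x₂ = (j₂,n₂) in ℤ×ℤ with |nᵢ − E| ≥ K and |nᵢ + jᵢ² − E| ≤ 2δ for i = 1,2, such that |φ(x)| ≤ C·(exp(−c·|x − x₁|₁) + exp(−c·|x − x₂|₁)) for all x ∈ ℤ×ℤ. -/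

import Mathlib

noncomputable section

/-- The Floquet Hamiltonian `H = diag (n + j²) + δ Δ̃` acting on functions on `ℤ × ℤ`. -/
def Hfl (δ : ℝ) (φ : ℤ × ℤ → ℂ) : ℤ × ℤ → ℂ := fun p =>
  ((p.2 + p.1 ^ 2 : ℤ) : ℂ) * φ p +
    (δ : ℂ) * (φ (p.1 + 1, p.2 + 1) + φ (p.1 + 1, p.2 - 1) +
               φ (p.1 - 1, p.2 + 1) + φ (p.1 - 1, p.2 - 1))

/-- The ℓ¹ distance on `ℤ × ℤ`. -/
def dist1 (x y : ℤ × ℤ) : ℤ := |x.1 - y.1| + |x.2 - y.2|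

/-- The sup norm on `ℤ × ℤ`: the number of hops from the origin. -/
def supNorm (a b : ℤ) : ℕ := max a.natAbs b.natAbs

/-- The diagonal hopping operator. -/
def hop (u : ℤ → ℤ → ℂ) (a b : ℤ) : ℂ :=
  u (a + 1) (b + 1) + u (a + 1) (b - 1) + u (a - 1) (b + 1) + u (a - 1) (b - 1)

/-- An eigenfunction centred at a resonant site `(±s, n)`, normalized there, restricted to the
sublattice of the centre, and growing at most like `2 ^ |x|`. -/
structure IsLocalSol (δ e : ℝ) (s : ℕ) (u : ℤ → ℤ → ℂ) : Prop where
  eq : ∀ a b : ℤ, ((((b + a ^ 2 + 2 * s * a : ℤ) : ℝ) - e : ℝ) : ℂ) * u a b + δ * hop u a b = 0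
  one : u 0 0 = 1
  odd : ∀ a b : ℤ, (a + b) % 2 ≠ 0 → u a b = 0
  le : ∀ a b : ℤ, ‖u a b‖ ≤ 2 ^ supNorm a b

theorem norm_le_of_eq {w δ r : ℝ} {x y : ℂ} (hδ : 0 ≤ δ) (hr : 0 < r) (hw : r ≤ |w|)
    (h : (w : ℂ) * x + δ * y = 0) : ‖x‖ ≤ δ / r * ‖y‖ := by
  have h1 : (w : ℂ) * x = -(δ * y) := by linear_combination h
  have h2 : |w| * ‖x‖ = δ * ‖y‖ := by
    have := congrArg norm h1
    rwa [norm_neg, norm_mul, norm_mul, Complex.norm_real, Complex.norm_real, Real.norm_eq_abs,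
      Real.norm_eq_abs, abs_of_nonneg hδ] at this
  rw [div_mul_eq_mul_div, le_div_iff₀ hr, ← h2, mul_comm]
  exact mul_le_mul_of_nonneg_right hw (norm_nonneg _)

theorem norm_hop_le {u : ℤ → ℤ → ℂ} {a b : ℤ} {M : ℝ}
    (h : ∀ s t : ℤ, (s = 1 ∨ s = -1) → (t = 1 ∨ t = -1) → ‖u (a + s) (b + t)‖ ≤ M) :
    ‖hop u a b‖ ≤ 4 * M := by
  have h1 := h 1 1 (by simp) (by simp)
  have h2 := h 1 (-1) (by simp) (by simp)
  have h3 := h (-1) 1 (by simp) (by simp)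
  have h4 := h (-1) (-1) (by simp) (by simp)
  simp only [← sub_eq_add_neg] at h1 h2 h3 h4
  have := norm_add₄_le (a := u (a + 1) (b + 1)) (b := u (a + 1) (b - 1)) (c := u (a - 1) (b + 1))
    (d := u (a - 1) (b - 1))
  unfold hop
  linarith

theorem potential_ne_zero {s : ℕ} {a b : ℤ} (h0 : ¬(a = 0 ∧ b = 0))
    (h : supNorm a b + 2 ≤ 2 * s) : b + a ^ 2 + 2 * s * a ≠ 0 := by
  unfold supNorm at h
  intro hb
  rcases lt_trichotomy a 0 with ha | ha | ha
  · have : 0 ≤ (-a - 1) * (a + 2 * s - 1) := mul_nonneg (by omega) (by omega)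
    have hb' : b ≥ 2 * s - 1 := by nlinarith
    omega
  · subst ha
    apply h0
    simpa using hb
  · have hb' : b ≤ -(2 * s) := by nlinarith
    omega

theorem one_half_le_abs_sub {W : ℤ} {e : ℝ} (he : |e| ≤ 1 / 8) (h : W ≠ 0) :
    1 / 2 ≤ |(W : ℝ) - e| := by
  have h1 : (1 : ℝ) ≤ |(W : ℝ)| := by exact_mod_cast Int.one_le_abs h
  have := abs_sub_abs_le_abs_sub (W : ℝ) e
  linarith

theorem potential_lower {s L : ℕ} {a b : ℤ} {e : ℝ} (he : |e| ≤ 1 / 8) (hs : 1 ≤ s)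
    (hL : 2 * L ≤ s) (ha : a ≠ 0) (h : supNorm a b ≤ L) :
    (s : ℝ) / 2 * |(a : ℝ)| ≤ |((b + a ^ 2 + 2 * s * a : ℤ) : ℝ) - e| := by
  have h1 : (s : ℤ) * |a| ≤ |b + a ^ 2 + 2 * s * a| := by
    unfold supNorm at h
    rcases lt_or_gt_of_ne ha with ha | ha
    · rw [abs_of_neg ha, le_abs]
      right
      have h2 : 0 ≤ (-a) * (a + L) := mul_nonneg (by omega) (by omega)
      have h3 : 0 ≤ (-a) * ((s : ℤ) - 2 * L) := mul_nonneg (by omega) (by omega)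
      have h4 : 0 ≤ (-a - 1) * (L : ℤ) := mul_nonneg (by omega) (by omega)
      have h5 : b ≤ L := by omega
      nlinarith
    · rw [abs_of_pos ha, le_abs]
      left
      have h5 : -b ≤ s := by omega
      nlinarith
  have h2 : (s : ℝ) * |(a : ℝ)| ≤ |((b + a ^ 2 + 2 * s * a : ℤ) : ℝ)| := by exact_mod_cast h1
  have h3 := abs_sub_abs_le_abs_sub ((b + a ^ 2 + 2 * s * a : ℤ) : ℝ) e
  have h4 : (1 : ℝ) ≤ |(a : ℝ)| := by exact_mod_cast Int.one_le_abs ha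
  have h5 : (1 : ℝ) ≤ s := by exact_mod_cast hs
  nlinarith

theorem supNorm_add_le {a b s t : ℤ} (hs : s = 1 ∨ s = -1) (ht : t = 1 ∨ t = -1) :
    supNorm (a + s) (b + t) ≤ supNorm a b + 1 ∧ supNorm a b ≤ supNorm (a + s) (b + t) + 1 := by
  unfold supNorm; omega

namespace IsLocalSol

variable {δ e : ℝ} {s : ℕ} {u : ℤ → ℤ → ℂ}

/-- One step of the decay estimate away from the centre and its neighbours. -/
theorem norm_le_hop (h : IsLocalSol δ e s u) (hδ : 0 ≤ δ) (he : |e| ≤ 1 / 8) {a b : ℤ}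
    (h0 : ¬(a = 0 ∧ b = 0)) (hs : supNorm a b + 2 ≤ 2 * s) : ‖u a b‖ ≤ 2 * δ * ‖hop u a b‖ := by
  have := norm_le_of_eq hδ (by norm_num : (0 : ℝ) < 1 / 2)
    (one_half_le_abs_sub he (potential_ne_zero h0 hs)) (h.eq a b)
  linarith

theorem norm_le_hop_box (h : IsLocalSol δ e s u) (hδ : 0 ≤ δ) (he : |e| ≤ 1 / 8) (hs : 1 ≤ s)
    {L : ℕ} {a b : ℤ} (hL : 2 * L ≤ s) (ha : a ≠ 0) (hab : supNorm a b ≤ L) :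
    |(a : ℝ)| * ‖u a b‖ ≤ 2 * δ / s * ‖hop u a b‖ := by
  have hs' : (0 : ℝ) < s := by exact_mod_cast hs
  have ha' : (0 : ℝ) < |(a : ℝ)| := by positivity
  have := norm_le_of_eq hδ (by positivity) (potential_lower he hs hL ha hab) (h.eq a b)
  calc |(a : ℝ)| * ‖u a b‖ ≤ |(a : ℝ)| * (δ / (s / 2 * |(a : ℝ)|) * ‖hop u a b‖) := by gcongr
    _ = _ := by field_simp

theorem decay_aux (h : IsLocalSol δ e s u) (hδ : 0 < δ) (hδ' : δ ≤ 1 / 100) (he : |e| ≤ 1 / 8)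
    (hs : 2 ≤ s) (n : ℕ) : ∀ a b : ℤ, ¬(a = 0 ∧ b = 0) → supNorm a b + n + 1 ≤ 2 * s →
    ‖u a b‖ ≤ 8 * δ / s * (8 * δ) ^ (supNorm a b - 1) + (16 * δ) ^ n * 2 ^ supNorm a b := by
  have hs' : (2 : ℝ) ≤ s := by exact_mod_cast hs
  induction n with
  | zero =>
    intro a b _ _
    have := h.le a b
    have : 0 ≤ 8 * δ / s * (8 * δ) ^ (supNorm a b - 1) := by positivity
    linarith
  | succ n ih =>
    intro a b h0 hn
    have hq0 : 0 ≤ 8 * δ := by linarith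
    have hq1 : 8 * δ ≤ 1 := by linarith
    have key : ∀ s' t : ℤ, (s' = 1 ∨ s' = -1) → (t = 1 ∨ t = -1) →
        ¬(a + s' = 0 ∧ b + t = 0) → 8 * δ * ‖u (a + s') (b + t)‖ ≤
        8 * δ / s * (8 * δ) ^ (supNorm a b - 1) + (16 * δ) ^ (n + 1) * 2 ^ supNorm a b := by
      intro s' t hs' ht hne
      obtain ⟨h1, h2⟩ := supNorm_add_le (a := a) (b := b) hs' ht
      have h3 := ih (a + s') (b + t) hne (by omega)
      have hpos : 1 ≤ supNorm (a + s') (b + t) := by unfold supNorm; omega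
      have h4 : (8 * δ) ^ (supNorm (a + s') (b + t) - 1 + 1) ≤ (8 * δ) ^ (supNorm a b - 1) :=
        pow_le_pow_of_le_one hq0 hq1 (by omega)
      have h5 : (2 : ℝ) ^ supNorm (a + s') (b + t) ≤ 2 ^ (supNorm a b + 1) :=
        pow_le_pow_right₀ (by norm_num) h1
      calc 8 * δ * ‖u (a + s') (b + t)‖ ≤ 8 * δ * (8 * δ / s * (8 * δ) ^ (supNorm (a + s') (b + t) - 1)
            + (16 * δ) ^ n * 2 ^ supNorm (a + s') (b + t)) := by gcongr
        _ = 8 * δ / s * (8 * δ) ^ (supNorm (a + s') (b + t) - 1 + 1)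
            + 8 * δ * (16 * δ) ^ n * 2 ^ supNorm (a + s') (b + t) := by ring
        _ ≤ 8 * δ / s * (8 * δ) ^ (supNorm a b - 1)
            + 8 * δ * (16 * δ) ^ n * 2 ^ (supNorm a b + 1) := by gcongr
        _ = _ := by ring
    by_cases hN : (a = 1 ∨ a = -1) ∧ (b = 1 ∨ b = -1)
    · have h1 : supNorm a b = 1 := by unfold supNorm; omega
      have hlow : (s : ℝ) / 2 ≤ |((b + a ^ 2 + 2 * s * a : ℤ) : ℝ) - e| := by
        have := abs_le.1 he
        rcases hN with ⟨rfl | rfl, rfl | rfl⟩ <;> push_cast <;> rw [le_abs] <;>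
          first
          | (left; linarith)
          | (right; linarith)
      have h2 := norm_le_of_eq hδ.le (by positivity) hlow (h.eq a b)
      set M := 1 + ((16 * δ) ^ (n + 1) * 2 ^ supNorm a b) / (8 * δ) with hM
      have h3 : ‖hop u a b‖ ≤ 4 * M := by
        refine norm_hop_le fun s' t hs' ht => ?_
        by_cases hne : a + s' = 0 ∧ b + t = 0
        · rw [hne.1, hne.2, h.one, norm_one, hM]
          have : 0 ≤ ((16 * δ) ^ (n + 1) * 2 ^ supNorm a b) / (8 * δ) := by positivity
          linarith
        · have := key s' t hs' ht hne
          rw [h1] at this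
          have h5 : 8 * δ / s ≤ 8 * δ := div_le_self hq0 (by linarith)
          rw [hM, h1]
          rw [← sub_nonneg] at this ⊢
          have h6 : 0 ≤ 8 * δ * (1 + (16 * δ) ^ (n + 1) * 2 ^ 1 / (8 * δ) - ‖u (a + s') (b + t)‖) := by
            have : 8 * δ * (1 + (16 * δ) ^ (n + 1) * 2 ^ 1 / (8 * δ) - ‖u (a + s') (b + t)‖) =
              8 * δ + (16 * δ) ^ (n + 1) * 2 ^ 1 - 8 * δ * ‖u (a + s') (b + t)‖ := by
              field_simp
            rw [this]
            simp only [tsub_self, pow_zero, mul_one] at *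
            linarith
          exact (mul_nonneg_iff_of_pos_left (by positivity)).1 h6
      have h4 : δ / (s / 2) * ‖hop u a b‖ ≤ 8 * δ / s * M := by
        calc δ / (s / 2) * ‖hop u a b‖ ≤ δ / (s / 2) * (4 * M) := by gcongr
          _ = _ := by field_simp; ring
      have h5 : 8 * δ / s * M = 8 * δ / s + (16 * δ) ^ (n + 1) * 2 ^ supNorm a b / s := by
        rw [hM]; field_simp
      have h6 : (16 * δ) ^ (n + 1) * 2 ^ supNorm a b / s ≤ (16 * δ) ^ (n + 1) * 2 ^ supNorm a b :=
        div_le_self (by positivity) (by linarith)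
      have h7 : 8 * δ / s * (8 * δ) ^ (supNorm a b - 1) = 8 * δ / s := by rw [h1]; simp
      rw [h7]
      linarith
    · have h2 := h.norm_le_hop hδ.le he h0 (by omega)
      set M := 8 * δ / s * (8 * δ) ^ (supNorm a b - 1) + (16 * δ) ^ (n + 1) * 2 ^ supNorm a b
      have h3 : ‖hop u a b‖ ≤ 4 * (M / (8 * δ)) := by
        refine norm_hop_le fun s' t hs' ht => ?_
        rw [le_div_iff₀ (by positivity), mul_comm]
        exact key s' t hs' ht (by omega)
      calc ‖u a b‖ ≤ 2 * δ * ‖hop u a b‖ := h2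
        _ ≤ 2 * δ * (4 * (M / (8 * δ))) := by gcongr
        _ = M := by field_simp; ring

/-- Decay of a local solution away from its centre. -/
theorem decay (h : IsLocalSol δ e s u) (hδ : 0 < δ) (hδ' : δ ≤ 1 / 1000) (he : |e| ≤ 1 / 8)
    (hs : 2 ≤ s) {a b : ℤ} (h0 : ¬(a = 0 ∧ b = 0)) (hab : supNorm a b ≤ s) :
    ‖u a b‖ ≤ 5000 * δ * (1 / 4) ^ supNorm a b / s := by
  have hs' : (2 : ℝ) ≤ s := by exact_mod_cast hs
  have h1 := h.decay_aux hδ (by linarith) he hs (s - 1) a b h0 (by omega)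
  obtain ⟨k, hk⟩ : ∃ k, supNorm a b = k + 1 := ⟨supNorm a b - 1, by unfold supNorm; omega⟩
  obtain ⟨t, rfl⟩ : ∃ t, s = t + 2 := ⟨s - 2, by omega⟩
  rw [hk] at *
  have hA : 8 * δ / ((t + 2 : ℕ) : ℝ) * (8 * δ) ^ (k + 1 - 1) ≤
      32 * δ * (1 / 4) ^ (k + 1) / ((t + 2 : ℕ) : ℝ) := by
    have : (8 * δ) ^ k ≤ (1 / 4) ^ k := by gcongr; linarith
    calc 8 * δ / ((t + 2 : ℕ) : ℝ) * (8 * δ) ^ (k + 1 - 1)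
        ≤ 8 * δ / ((t + 2 : ℕ) : ℝ) * (1 / 4) ^ k := by rw [Nat.add_sub_cancel]; gcongr
      _ = _ := by rw [pow_succ]; ring
  have hB : (16 * δ) ^ (t + 2 - 1) * 2 ^ (k + 1) ≤
      4096 * δ * (1 / 4) ^ (k + 1) / ((t + 2 : ℕ) : ℝ) := by
    rw [le_div_iff₀ (by positivity)]
    have e1 : (2 : ℝ) ^ (k + 1) = 8 ^ (k + 1) * (1 / 4) ^ (k + 1) := by
      rw [← mul_pow]; norm_num
    have e2 : (8 : ℝ) ^ (k + 1) ≤ 8 ^ (t + 2) := pow_le_pow_right₀ (by norm_num) hab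
    have e3 : ((t + 2 : ℕ) : ℝ) ≤ 2 ^ (t + 2) := by exact_mod_cast Nat.lt_two_pow_self.le
    have e4 : (16 * δ) ^ t * 16 ^ t ≤ 1 := by
      rw [← mul_pow]
      exact pow_le_one₀ (by positivity) (by linarith)
    calc (16 * δ) ^ (t + 2 - 1) * 2 ^ (k + 1) * ((t + 2 : ℕ) : ℝ)
        ≤ (16 * δ) ^ (t + 1) * (8 ^ (t + 2) * (1 / 4) ^ (k + 1)) * 2 ^ (t + 2) := by
          rw [e1, show t + 2 - 1 = t + 1 by omega]
          gcongr
      _ = 4096 * δ * (1 / 4) ^ (k + 1) * ((16 * δ) ^ t * 16 ^ t) := by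
          rw [show (16 : ℝ) ^ t = 8 ^ t * 2 ^ t by rw [← mul_pow]; norm_num]
          ring
      _ ≤ 4096 * δ * (1 / 4) ^ (k + 1) * 1 := by gcongr
      _ = _ := mul_one _
  have hpos : 0 ≤ δ * (1 / 4) ^ (k + 1) / ((t + 2 : ℕ) : ℝ) := by positivity
  have e5 : ∀ c : ℝ, c * δ * (1 / 4) ^ (k + 1) / ((t + 2 : ℕ) : ℝ) =
    c * (δ * (1 / 4) ^ (k + 1) / ((t + 2 : ℕ) : ℝ)) := fun c => by ring
  rw [e5] at hA hB ⊢
  linarith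

theorem abs_energy_le (h : IsLocalSol δ e s u) (hδ : 0 < δ) (hδ' : δ ≤ 1 / 1000) (he : |e| ≤ 1 / 8)
    (hs : 2 ≤ s) : |e| ≤ 5000 * δ ^ 2 / s := by
  have h1 := h.eq 0 0
  rw [h.one] at h1
  have h2 : (e : ℂ) = δ * hop u 0 0 := by
    push_cast at h1
    linear_combination -h1
  have h3 : ‖hop u 0 0‖ ≤ 4 * (5000 * δ * (1 / 4) ^ 1 / s) := by
    refine norm_hop_le fun a b ha hb => ?_
    have : supNorm (0 + a) (0 + b) = 1 := by unfold supNorm; omega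
    have h4 := h.decay hδ hδ' he hs (a := 0 + a) (b := 0 + b) (by omega) (by omega)
    rwa [this] at h4
  have h5 : |e| = δ * ‖hop u 0 0‖ := by
    have := congrArg norm h2
    rwa [norm_mul, Complex.norm_real, Complex.norm_real, Real.norm_eq_abs, Real.norm_eq_abs,
      abs_of_pos hδ] at this
  rw [h5]
  calc δ * ‖hop u 0 0‖ ≤ δ * (4 * (5000 * δ * (1 / 4) ^ 1 / s)) := by gcongr
    _ = _ := by ring

end IsLocalSol

theorem norm_sum_shift_sub_le (B : Finset (ℤ × ℤ)) (f g : ℤ × ℤ → ℂ) (s : ℤ × ℤ) {c : ℝ}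
    (h : ∀ x ∈ B, x + s ∉ B → ‖f x * g (x + s)‖ ≤ c)
    (h' : ∀ x ∈ B, x - s ∉ B → ‖g x * f (x - s)‖ ≤ c) (hc : 0 ≤ c) :
    ‖∑ x ∈ B, f x * g (x + s) - ∑ x ∈ B, g x * f (x - s)‖ ≤ 2 * B.card * c := by
  have h1 : ∑ x ∈ B with x + s ∈ B, f x * g (x + s) = ∑ x ∈ B with x - s ∈ B, g x * f (x - s) := by
    refine Finset.sum_nbij' (· + s) (· - s) ?_ ?_ ?_ ?_ ?_ <;> simp +contextual [mul_comm]
  rw [← Finset.sum_filter_add_sum_filter_not B (fun x => x + s ∈ B) (fun x => f x * g (x + s)),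
    ← Finset.sum_filter_add_sum_filter_not B (fun x => x - s ∈ B) (fun x => g x * f (x - s)),
    h1, add_sub_add_left_eq_sub]
  have bound : ∀ (p : ℤ × ℤ → Prop) [DecidablePred p] (F : ℤ × ℤ → ℂ),
      (∀ x ∈ B, p x → ‖F x‖ ≤ c) → ‖∑ x ∈ B with p x, F x‖ ≤ B.card * c := by
    intro p _ F hF
    calc ‖∑ x ∈ B with p x, F x‖ ≤ (B.filter p).card * c := by
          rw [← nsmul_eq_mul]
          refine (norm_sum_le_of_le _ fun x hx => ?_).trans (Finset.sum_const c).le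
          rw [Finset.mem_filter] at hx
          exact hF x hx.1 hx.2
      _ ≤ B.card * c := by gcongr; exact Finset.filter_subset _ _
  have h2 := bound (fun x => x + s ∉ B) _ h
  have h3 := bound (fun x => x - s ∉ B) _ h'
  refine (norm_sub_le _ _).trans ?_
  linarith

/-- The box of radius `L` around the origin. -/
def box (L : ℕ) : Finset (ℤ × ℤ) := Finset.Icc (-L : ℤ) L ×ˢ Finset.Icc (-L : ℤ) L

theorem mem_box {L : ℕ} {x : ℤ × ℤ} : x ∈ box L ↔ supNorm x.1 x.2 ≤ L := by
  simp only [box, Finset.mem_product, Finset.mem_Icc, supNorm]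
  omega

theorem card_box (L : ℕ) : (box L).card = (2 * L + 1) ^ 2 := by
  rw [box, Finset.card_product, Int.card_Icc, sq]
  congr 1 <;> omega

theorem sum_Icc_quarter_pow_le (L : ℕ) :
    ∑ a ∈ Finset.Icc (-L : ℤ) L, (1 / 4 : ℝ) ^ a.natAbs = 5 / 3 - 2 / 3 * (1 / 4) ^ L := by
  induction L with
  | zero => norm_num
  | succ L ih =>
    have h : Finset.Icc (-((L + 1 : ℕ) : ℤ)) ((L + 1 : ℕ) : ℤ) =
        insert ((L + 1 : ℕ) : ℤ) (insert (-((L + 1 : ℕ) : ℤ)) (Finset.Icc (-L : ℤ) L)) := by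
      ext x
      simp only [Finset.mem_Icc, Finset.mem_insert]
      omega
    rw [h, Finset.sum_insert, Finset.sum_insert, ih, Int.natAbs_neg, Int.natAbs_natCast]
    · ring
    · simp only [Finset.mem_Icc]; omega
    · simp only [Finset.mem_Icc, Finset.mem_insert]; omega

theorem sum_box_quarter_pow_le (L : ℕ) :
    ∑ x ∈ box L, (1 / 4 : ℝ) ^ (2 * supNorm x.1 x.2) ≤ 4 := by
  have h1 : ∑ x ∈ box L, (1 / 4 : ℝ) ^ (2 * supNorm x.1 x.2) ≤
      ∑ x ∈ box L, (1 / 4 : ℝ) ^ x.1.natAbs * (1 / 4 : ℝ) ^ x.2.natAbs := by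
    refine Finset.sum_le_sum fun x _ => ?_
    rw [← pow_add]
    exact pow_le_pow_of_le_one (by norm_num) (by norm_num) (by unfold supNorm; omega)
  have h4 : ∑ x ∈ box L, (1 / 4 : ℝ) ^ x.1.natAbs * (1 / 4 : ℝ) ^ x.2.natAbs =
      (5 / 3 - 2 / 3 * (1 / 4) ^ L) * (5 / 3 - 2 / 3 * (1 / 4) ^ L) := by
    rw [box, Finset.sum_product, ← sum_Icc_quarter_pow_le, Finset.sum_mul_sum]
  have h2 : (0 : ℝ) ≤ (1 / 4) ^ L := by positivity
  have h3 : (1 / 4 : ℝ) ^ L ≤ 1 := pow_le_one₀ (by norm_num) (by norm_num)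
  nlinarith

/-- The neighbours of the origin. -/
def nbrs : Finset (ℤ × ℤ) := {(1, 1), (1, -1), (-1, 1), (-1, -1)}

theorem mem_nbrs {x : ℤ × ℤ} : x ∈ nbrs ↔ (x.1 = 1 ∨ x.1 = -1) ∧ (x.2 = 1 ∨ x.2 = -1) := by
  obtain ⟨a, b⟩ := x
  simp only [nbrs, Finset.mem_insert, Finset.mem_singleton, Prod.mk.injEq]
  omega

namespace IsLocalSol

variable {δ e : ℝ} {s t L : ℕ} {u v : ℤ → ℤ → ℂ}

theorem sum_wronskian_le (hu : IsLocalSol δ e s u) (hv : IsLocalSol δ e t v) (hδ : 0 < δ)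
    (hδ' : δ ≤ 1 / 1000) (he : |e| ≤ 1 / 8) (hL : 1 ≤ L) (hs : L + 1 ≤ s) (ht : L + 1 ≤ t) :
    2 * |(t : ℝ) - s| * ‖∑ x ∈ box L, (x.1 : ℂ) * (u x.1 x.2 * v x.1 x.2)‖ ≤
      8 * (2 * L + 1) ^ 2 * δ * (5000 ^ 2 * δ ^ 2 * (1 / 4) ^ (2 * L + 1) / (s * t)) := by
  set c : ℝ := 5000 ^ 2 * δ ^ 2 * (1 / 4) ^ (2 * L + 1) / (s * t) with hc
  have hcross : ∀ {s t : ℕ} {u v : ℤ → ℤ → ℂ}, IsLocalSol δ e s u → IsLocalSol δ e t v →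
      L + 1 ≤ s → L + 1 ≤ t → ∀ x ∈ box L, ∀ y ∉ box L, supNorm y.1 y.2 ≤ supNorm x.1 x.2 + 1 →
      ‖u x.1 x.2 * v y.1 y.2‖ ≤ 5000 ^ 2 * δ ^ 2 * (1 / 4) ^ (2 * L + 1) / (s * t) := by
    intro s t u v hu hv hs ht x hx y hy hxy
    rw [mem_box] at hx hy
    have hx' : supNorm x.1 x.2 = L := by omega
    have hy' : supNorm y.1 y.2 = L + 1 := by omega
    have h1 := hu.decay hδ hδ' he (by omega) (a := x.1) (b := x.2)
      (by unfold supNorm at hx'; omega) (by omega)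
    have h2 := hv.decay hδ hδ' he (by omega) (a := y.1) (b := y.2)
      (by unfold supNorm at hy'; omega) (by omega)
    rw [hx'] at h1
    rw [hy'] at h2
    rw [norm_mul]
    refine (mul_le_mul h1 h2 (norm_nonneg _) (by positivity)).trans (le_of_eq ?_)
    field_simp
    ring
  have hshift : ∀ r : ℤ × ℤ, supNorm r.1 r.2 ≤ 1 →
      ‖∑ x ∈ box L, v x.1 x.2 * u (x + r).1 (x + r).2 -
        ∑ x ∈ box L, u x.1 x.2 * v (x - r).1 (x - r).2‖ ≤ 2 * (box L).card * c := by
    intro r hr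
    refine norm_sum_shift_sub_le (box L) (fun x => v x.1 x.2) (fun x => u x.1 x.2) r ?_ ?_
      (by positivity)
    · intro x hx hy
      have := hcross hv hu ht hs x hx (x + r) hy (by
        unfold supNorm at *; simp only [Prod.fst_add, Prod.snd_add]; omega)
      rwa [mul_comm (t : ℝ)] at this
    · intro x hx hy
      exact hcross hu hv hs ht x hx (x - r) hy (by
        unfold supNorm at *; simp only [Prod.fst_sub, Prod.snd_sub]; omega)
  have key : (2 * ((t : ℂ) - s)) * ∑ x ∈ box L, (x.1 : ℂ) * (u x.1 x.2 * v x.1 x.2) =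
      δ * ∑ x ∈ box L, (v x.1 x.2 * hop u x.1 x.2 - u x.1 x.2 * hop v x.1 x.2) := by
    rw [Finset.mul_sum, Finset.mul_sum]
    refine Finset.sum_congr rfl fun x _ => ?_
    have h1 := hu.eq x.1 x.2
    have h2 := hv.eq x.1 x.2
    push_cast at h1 h2
    linear_combination u x.1 x.2 * h2 - v x.1 x.2 * h1
  have hsplit : ∑ x ∈ box L, (v x.1 x.2 * hop u x.1 x.2 - u x.1 x.2 * hop v x.1 x.2) =
      ∑ r ∈ nbrs, (∑ x ∈ box L, v x.1 x.2 * u (x + r).1 (x + r).2 -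
        ∑ x ∈ box L, u x.1 x.2 * v (x - r).1 (x - r).2) := by
    simp_rw [← Finset.sum_sub_distrib]
    rw [Finset.sum_comm]
    refine Finset.sum_congr rfl fun x _ => ?_
    simp only [nbrs, hop]
    rw [Finset.sum_insert (by decide), Finset.sum_insert (by decide),
      Finset.sum_insert (by decide), Finset.sum_singleton]
    simp only [Prod.fst_add, Prod.snd_add, Prod.fst_sub, Prod.snd_sub, ← sub_eq_add_neg,
      sub_neg_eq_add]
    ring
  have hnorm := congrArg norm key
  rw [norm_mul, norm_mul (δ : ℂ), Complex.norm_real, Real.norm_eq_abs, abs_of_pos hδ, hsplit] at hnorm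
  have h2 : ‖(2 * ((t : ℂ) - s))‖ = 2 * |(t : ℝ) - s| := by
    rw [norm_mul, ← Complex.ofReal_natCast, ← Complex.ofReal_natCast, ← Complex.ofReal_sub,
      Complex.norm_real, Real.norm_eq_abs]
    simp
  rw [h2] at hnorm
  rw [hnorm]
  have h3 : ‖∑ r ∈ nbrs, (∑ x ∈ box L, v x.1 x.2 * u (x + r).1 (x + r).2 -
        ∑ x ∈ box L, u x.1 x.2 * v (x - r).1 (x - r).2)‖ ≤ nbrs.card • (2 * (box L).card * c) := by
    refine (norm_sum_le_of_le _ fun r hr => hshift r ?_).trans (Finset.sum_const _).le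
    rw [mem_nbrs] at hr
    unfold supNorm
    omega
  have h4 : nbrs.card = 4 := by decide
  rw [h4, card_box] at h3
  calc δ * _ ≤ δ * (4 • (2 * (((2 * L + 1) ^ 2 : ℕ) : ℝ) * c)) := by gcongr
    _ = _ := by rw [nsmul_eq_mul]; push_cast; ring

theorem norm_hop_nbr_sub_one_le (h : IsLocalSol δ e s u) (hδ : 0 < δ)
    (hδ' : δ ≤ 1 / 1000) (he : |e| ≤ 1 / 8) (hs : 2 ≤ s) {x : ℤ × ℤ} (hx : x ∈ nbrs) :
    ‖hop u x.1 x.2 - 1‖ ≤ 1000 * δ / s := by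
  have hb : ∀ a b : ℤ, supNorm a b = 2 → ‖u a b‖ ≤ 5000 / 16 * (δ / s) := by
    intro a b hab
    have := h.decay hδ hδ' he hs (a := a) (b := b) (by unfold supNorm at hab; omega) (by omega)
    rw [hab] at this
    refine this.trans (le_of_eq ?_)
    ring
  have h3 : ∀ y z w : ℂ, ‖y‖ ≤ 5000 / 16 * (δ / s) → ‖z‖ ≤ 5000 / 16 * (δ / s) →
      ‖w‖ ≤ 5000 / 16 * (δ / s) → ‖y + z + w‖ ≤ 1000 * δ / s := by
    intro y z w hy hz hw
    have : 0 ≤ δ / s := by positivity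
    have := norm_add₃_le (a := y) (b := z) (c := w)
    rw [mul_div_assoc]
    linarith
  obtain ⟨a, b⟩ := x
  rw [mem_nbrs] at hx
  simp only at hx ⊢
  obtain ⟨rfl | rfl, rfl | rfl⟩ := hx
  · convert h3 (u 2 2) (u 2 0) (u 0 2) (hb _ _ rfl) (hb _ _ rfl) (hb _ _ rfl) using 2
    norm_num [hop, h.one]
  · convert h3 (u 2 0) (u 2 (-2)) (u 0 (-2)) (hb _ _ rfl) (hb _ _ rfl) (hb _ _ rfl) using 2
    norm_num [hop, h.one]; ring
  · convert h3 (u 0 2) (u (-2) 2) (u (-2) 0) (hb _ _ rfl) (hb _ _ rfl) (hb _ _ rfl) using 2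
    norm_num [hop, h.one]; ring
  · convert h3 (u 0 (-2)) (u (-2) 0) (u (-2) (-2)) (hb _ _ rfl) (hb _ _ rfl) (hb _ _ rfl) using 2
    norm_num [hop, h.one]; ring

/-- The leading order of `u * v` at the neighbours of the centre. -/
theorem norm_nbr_sub_le (hu : IsLocalSol δ e s u) (hv : IsLocalSol δ e t v) (hδ : 0 < δ)
    (hδ' : δ ≤ 1 / 1000) (he : |e| ≤ 1 / 8) (hs : 2 ≤ s) (hst : s ≤ t) {x : ℤ × ℤ}
    (hx : x ∈ nbrs) :
    ‖(x.1 : ℂ) * (u x.1 x.2 * v x.1 x.2) - ((x.1 * (δ ^ 2 /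
      ((((x.2 + x.1 ^ 2 + 2 * s * x.1 : ℤ) : ℝ) - e) *
        (((x.2 + x.1 ^ 2 + 2 * t * x.1 : ℤ) : ℝ) - e))) : ℝ) : ℂ)‖ ≤
      12000 * δ ^ 3 / (s ^ 2 * t) := by
  have hs' : (2 : ℝ) ≤ s := by exact_mod_cast hs
  have hst' : (s : ℝ) ≤ t := by exact_mod_cast hst
  have hlow : ∀ {s : ℝ}, 2 ≤ s → s / 2 ≤ |(x.2 + x.1 ^ 2 + 2 * s * x.1 : ℝ) - e| := by
    intro s hs'
    obtain ⟨a, b⟩ := x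
    rw [mem_nbrs] at hx
    have := abs_le.1 he
    obtain ⟨rfl | rfl, rfl | rfl⟩ := hx <;> push_cast <;> rw [le_abs] <;>
      first
      | (left; linarith)
      | (right; linarith)
  have hx1 : ‖(x.1 : ℂ)‖ = 1 := by
    rw [mem_nbrs] at hx
    rcases hx.1 with h | h <;> simp [h]
  have hε := hu.norm_hop_nbr_sub_one_le hδ hδ' he hs hx
  have hε' := hv.norm_hop_nbr_sub_one_le hδ hδ' he (hs.trans hst) hx
  have h1 := hu.eq x.1 x.2
  have h2 := hv.eq x.1 x.2
  have hw := hlow hs'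
  have hw' := hlow (hs'.trans hst')
  push_cast at h1 h2 ⊢
  set w : ℝ := x.2 + x.1 ^ 2 + 2 * s * x.1 - e with hwdef
  set w' : ℝ := x.2 + x.1 ^ 2 + 2 * t * x.1 - e with hwdef'
  have hwc : (x.2 + x.1 ^ 2 + 2 * s * x.1 - e : ℂ) = (w : ℂ) := by rw [hwdef]; push_cast; rfl
  have hwc' : (x.2 + x.1 ^ 2 + 2 * t * x.1 - e : ℂ) = (w' : ℂ) := by rw [hwdef']; push_cast; rfl
  rw [hwc] at h1 ⊢
  rw [hwc'] at h2 ⊢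
  have hw0 : (w : ℂ) ≠ 0 := by
    rw [Complex.ofReal_ne_zero]
    exact abs_pos.1 (lt_of_lt_of_le (by positivity) hw)
  have hw0' : (w' : ℂ) ≠ 0 := by
    rw [Complex.ofReal_ne_zero]
    exact abs_pos.1 (lt_of_lt_of_le (by linarith) hw')
  set ε := hop u x.1 x.2 - 1
  set ε' := hop v x.1 x.2 - 1
  have e1 : u x.1 x.2 = -(δ / w) * (1 + ε) := by
    simp only [ε]; field_simp; linear_combination h1
  have e2 : v x.1 x.2 = -(δ / w') * (1 + ε') := by
    simp only [ε']; field_simp; linear_combination h2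
  have e3 : (x.1 : ℂ) * (u x.1 x.2 * v x.1 x.2) - x.1 * (δ ^ 2 / (w * w')) =
      x.1 * ((δ ^ 2 / (w * w')) * (ε + ε' + ε * ε')) := by
    rw [e1, e2]; field_simp; ring
  rw [e3, norm_mul, hx1, one_mul, norm_mul]
  have hd0 : 1000 * δ / s ≤ 1 := by
    rw [div_le_one (by linarith)]; linarith
  have hε'' : ‖ε'‖ ≤ 1000 * δ / s := hε'.trans (by gcongr)
  have h5 : ‖ε + ε' + ε * ε'‖ ≤ 3000 * δ / s := by
    have := norm_add₃_le (a := ε) (b := ε') (c := ε * ε')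
    have h6 : ‖ε * ε'‖ ≤ 1000 * δ / s := by
      rw [norm_mul]
      calc ‖ε‖ * ‖ε'‖ ≤ 1000 * δ / s * 1 := by gcongr; exact hε''.trans hd0
        _ = _ := mul_one _
    have h7 : 3000 * δ / s = 3 * (1000 * δ / s) := by ring
    linarith
  have h6 : ‖(δ : ℂ) ^ 2 / (w * w')‖ ≤ δ ^ 2 / (s / 2 * (t / 2)) := by
    rw [norm_div, norm_mul, norm_pow, Complex.norm_real, Complex.norm_real, Complex.norm_real,
      Real.norm_eq_abs, Real.norm_eq_abs, Real.norm_eq_abs, abs_of_pos hδ]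
    have : (0 : ℝ) < t := by linarith
    gcongr
  calc _ ≤ δ ^ 2 / (s / 2 * (t / 2)) * (3000 * δ / s) := by gcongr
    _ = _ := by field_simp; ring

theorem norm_rest_le (hu : IsLocalSol δ e s u) (hv : IsLocalSol δ e t v) (hδ : 0 < δ)
    (hδ' : δ ≤ 1 / 1000) (he : |e| ≤ 1 / 8) (hL : 2 * L ≤ s) (hs : 2 ≤ s) (hst : s ≤ t)
    {x : ℤ × ℤ} (hx : x ∈ box L) (hx' : x ∉ nbrs) :
    ‖(x.1 : ℂ) * (u x.1 x.2 * v x.1 x.2)‖ ≤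
      8 * 10 ^ 8 * δ ^ 3 / (s ^ 2 * t) * (1 / 4) ^ (2 * supNorm x.1 x.2) := by
  obtain ⟨a, b⟩ := x
  rw [mem_box] at hx
  rw [mem_nbrs] at hx'
  simp only at hx hx' ⊢
  have hpos : 0 ≤ 8 * 10 ^ 8 * δ ^ 3 / (s ^ 2 * t) * (1 / 4) ^ (2 * supNorm a b) := by positivity
  by_cases ha : a = 0
  · simpa [ha] using hpos
  by_cases hodd : (a + b) % 2 ≠ 0
  · simpa [hu.odd a b hodd] using hpos
  obtain ⟨k, hk⟩ : ∃ k, supNorm a b = k + 1 := ⟨supNorm a b - 1, by unfold supNorm; omega⟩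
  have h1 : ‖hop u a b‖ ≤ 4 * (5000 * δ * (1 / 4) ^ k / s) := by
    refine norm_hop_le fun c d hc hd => ?_
    have hn := supNorm_add_le (a := a) (b := b) hc hd
    refine (hu.decay hδ hδ' he hs (by omega) (by omega)).trans ?_
    have : (1 / 4 : ℝ) ^ supNorm (a + c) (b + d) ≤ (1 / 4) ^ k :=
      pow_le_pow_of_le_one (by norm_num) (by norm_num) (by omega)
    gcongr
  have h2 := hu.norm_le_hop_box hδ.le he (by omega) hL ha hx
  have h3 := hv.decay hδ hδ' he (hs.trans hst) (a := a) (b := b) (by omega) (by omega)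
  have h4 : ‖(a : ℂ) * (u a b * v a b)‖ = (|(a : ℝ)| * ‖u a b‖) * ‖v a b‖ := by
    rw [norm_mul, norm_mul, Complex.norm_intCast, mul_assoc]
  rw [h4, hk]
  rw [hk] at h3
  calc (|(a : ℝ)| * ‖u a b‖) * ‖v a b‖
      ≤ (2 * δ / s * (4 * (5000 * δ * (1 / 4) ^ k / s))) * (5000 * δ * (1 / 4) ^ (k + 1) / t) := by
        refine mul_le_mul (h2.trans ?_) h3 (norm_nonneg _) (by positivity)
        gcongr
    _ = _ := by
        field_simp
        ring

end IsLocalSol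

/-- The second-order separation of two resonances. -/
theorem leading_term_le {x y e : ℝ} (hx : 2 ≤ x) (hxy : x ≤ y) (he : |e| ≤ 1 / 8) :
    1 / ((2 + 2 * x - e) * (2 + 2 * y - e)) + 1 / ((2 * x - e) * (2 * y - e)) -
      1 / ((2 - 2 * x - e) * (2 - 2 * y - e)) - 1 / ((-2 * x - e) * (-2 * y - e)) ≤
      -(1 / (4 * (x ^ 2 * y))) := by
  obtain ⟨he1, he2⟩ := abs_le.1 he
  have hy : 2 ≤ y := hx.trans hxy
  have hx2 : 4 ≤ x ^ 2 := by nlinarith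
  have hy2 : 4 ≤ y ^ 2 := by nlinarith
  have hpair : ∀ α : ℝ, |α| < 4 → 1 / ((2 * x + α) * (2 * y + α)) -
      1 / ((2 * x - α) * (2 * y - α)) =
      -(4 * α * (x + y)) / ((4 * x ^ 2 - α ^ 2) * (4 * y ^ 2 - α ^ 2)) := by
    intro α hα
    obtain ⟨h1, h2⟩ := abs_lt.1 hα
    have a1 : 2 * x + α ≠ 0 := by linarith
    have a2 : 2 * y + α ≠ 0 := by linarith
    have a3 : 2 * x - α ≠ 0 := by linarith
    have a4 : 2 * y - α ≠ 0 := by linarith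
    rw [show 4 * x ^ 2 - α ^ 2 = (2 * x + α) * (2 * x - α) by ring,
      show 4 * y ^ 2 - α ^ 2 = (2 * y + α) * (2 * y - α) by ring]
    field_simp
    ring
  have h1 := hpair (2 - e) (by rw [abs_lt]; constructor <;> linarith)
  have h2 := hpair (-e) (by rw [abs_lt]; constructor <;> linarith)
  have hsum : 1 / ((2 + 2 * x - e) * (2 + 2 * y - e)) + 1 / ((2 * x - e) * (2 * y - e)) -
      1 / ((2 - 2 * x - e) * (2 - 2 * y - e)) - 1 / ((-2 * x - e) * (-2 * y - e)) =
      (1 / ((2 * x + (2 - e)) * (2 * y + (2 - e))) - 1 / ((2 * x - (2 - e)) * (2 * y - (2 - e)))) +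
      (1 / ((2 * x + (-e)) * (2 * y + (-e))) - 1 / ((2 * x - (-e)) * (2 * y - (-e)))) := by
    rw [show (2 + 2 * x - e) * (2 + 2 * y - e) = (2 * x + (2 - e)) * (2 * y + (2 - e)) by ring,
      show (2 - 2 * x - e) * (2 - 2 * y - e) = (2 * x - (2 - e)) * (2 * y - (2 - e)) by ring,
      show (-2 * x - e) * (-2 * y - e) = (2 * x - (-e)) * (2 * y - (-e)) by ring,
      show (2 * x - e) * (2 * y - e) = (2 * x + (-e)) * (2 * y + (-e)) by ring]
    ring
  rw [hsum, h1, h2]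
  have hq : 0 < x ^ 2 * y := by positivity
  have b1 : -(4 * (2 - e) * (x + y)) / ((4 * x ^ 2 - (2 - e) ^ 2) * (4 * y ^ 2 - (2 - e) ^ 2)) ≤
      -(7 / 16) * (1 / (x ^ 2 * y)) := by
    have c1 : 0 < 4 * x ^ 2 - (2 - e) ^ 2 := by nlinarith
    have c2 : 0 < 4 * y ^ 2 - (2 - e) ^ 2 := by nlinarith
    have c3 : (4 * x ^ 2 - (2 - e) ^ 2) * (4 * y ^ 2 - (2 - e) ^ 2) ≤ (4 * x ^ 2) * (4 * y ^ 2) :=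
      mul_le_mul (by nlinarith) (by nlinarith) c2.le (by positivity)
    rw [neg_div, neg_mul, neg_le_neg_iff, mul_one_div, div_le_div_iff₀ hq (by positivity)]
    calc 7 / 16 * ((4 * x ^ 2 - (2 - e) ^ 2) * (4 * y ^ 2 - (2 - e) ^ 2))
        ≤ 7 / 16 * ((4 * x ^ 2) * (4 * y ^ 2)) := by gcongr
      _ = 7 * y * (x ^ 2 * y) := by ring
      _ ≤ 4 * (2 - e) * (x + y) * (x ^ 2 * y) :=
        mul_le_mul_of_nonneg_right (by nlinarith) hq.le
  have b2 : -(4 * (-e) * (x + y)) / ((4 * x ^ 2 - (-e) ^ 2) * (4 * y ^ 2 - (-e) ^ 2)) ≤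
      (1 / 9) * (1 / (x ^ 2 * y)) := by
    have c1 : 3 * x ^ 2 ≤ 4 * x ^ 2 - (-e) ^ 2 := by nlinarith
    have c2 : 3 * y ^ 2 ≤ 4 * y ^ 2 - (-e) ^ 2 := by nlinarith
    have c3 : (3 * x ^ 2) * (3 * y ^ 2) ≤ (4 * x ^ 2 - (-e) ^ 2) * (4 * y ^ 2 - (-e) ^ 2) :=
      mul_le_mul c1 c2 (by positivity) (by nlinarith)
    rw [mul_one_div, div_le_div_iff₀ (lt_of_lt_of_le (by positivity) c3) hq]
    calc -(4 * (-e) * (x + y)) * (x ^ 2 * y) ≤ y * (x ^ 2 * y) := by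
          gcongr
          nlinarith
      _ = 1 / 9 * ((3 * x ^ 2) * (3 * y ^ 2)) := by ring
      _ ≤ _ := by gcongr
  have b3 : 1 / (4 * (x ^ 2 * y)) = (1 / 4) * (1 / (x ^ 2 * y)) := by field_simp
  have b4 : 0 < 1 / (x ^ 2 * y) := by positivity
  rw [b3]
  linarith

theorem cube_le_four_pow (n : ℕ) : n ^ 3 ≤ 4 ^ n := by
  rcases lt_or_ge n 4 with h | h
  · interval_cases n <;> norm_num
  · induction n, h using Nat.le_induction with
    | base => norm_num
    | succ n hn ih =>
      rw [pow_succ 4]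
      nlinarith [mul_le_mul hn hn (by omega) (by omega)]

namespace IsLocalSol

variable {δ e : ℝ} {s t : ℕ} {u v : ℤ → ℤ → ℂ}

theorem not_lt (hu : IsLocalSol δ e s u) (hv : IsLocalSol δ e t v) (hδ : 0 < δ)
    (hδ' : δ ≤ 1 / 10 ^ 11) (he : |e| ≤ 1 / 8) (hs : 2 ≤ s) : ¬s < t := by
  intro hst
  have hδ1 : δ ≤ 1 / 1000 := hδ'.trans (by norm_num)
  have hs' : (2 : ℝ) ≤ s := by exact_mod_cast hs
  have hst' : (s : ℝ) + 1 ≤ t := by exact_mod_cast hst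
  have ht0 : (0 : ℝ) < t := by linarith
  obtain ⟨L, hL⟩ : ∃ L, L = s / 2 := ⟨_, rfl⟩
  have hupper := hu.sum_wronskian_le hv hδ hδ1 he (L := L) (by omega) (by omega) (by omega)
  set S := ∑ x ∈ box L, (x.1 : ℂ) * (u x.1 x.2 * v x.1 x.2) with hS
  have hsub : nbrs ⊆ box L := by
    intro x hx
    rw [mem_nbrs] at hx
    rw [mem_box]
    unfold supNorm
    omega
  have hsplit := Finset.sum_sdiff hsub (f := fun x : ℤ × ℤ => (x.1 : ℂ) * (u x.1 x.2 * v x.1 x.2))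
  have hrest : ‖∑ x ∈ box L \ nbrs, (x.1 : ℂ) * (u x.1 x.2 * v x.1 x.2)‖ ≤
      8 * 10 ^ 8 * δ ^ 3 / (s ^ 2 * t) * 4 := by
    calc _ ≤ ∑ x ∈ box L \ nbrs, 8 * 10 ^ 8 * δ ^ 3 / (s ^ 2 * t) *
            (1 / 4) ^ (2 * supNorm x.1 x.2) := by
          refine norm_sum_le_of_le _ fun x hx => ?_
          rw [Finset.mem_sdiff] at hx
          exact hu.norm_rest_le hv hδ hδ1 he (by omega) hs hst.le hx.1 hx.2
      _ ≤ ∑ x ∈ box L, 8 * 10 ^ 8 * δ ^ 3 / (s ^ 2 * t) * (1 / 4) ^ (2 * supNorm x.1 x.2) :=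
          Finset.sum_le_sum_of_subset_of_nonneg Finset.sdiff_subset fun x _ _ => by positivity
      _ = 8 * 10 ^ 8 * δ ^ 3 / (s ^ 2 * t) * ∑ x ∈ box L, (1 / 4) ^ (2 * supNorm x.1 x.2) := by
          rw [Finset.mul_sum]
      _ ≤ _ := by gcongr; exact sum_box_quarter_pow_le L
  set m : ℤ × ℤ → ℝ := fun x => x.1 * (δ ^ 2 /
      ((((x.2 + x.1 ^ 2 + 2 * s * x.1 : ℤ) : ℝ) - e) *
        (((x.2 + x.1 ^ 2 + 2 * t * x.1 : ℤ) : ℝ) - e))) with hm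
  have hnbr : ‖∑ x ∈ nbrs, ((x.1 : ℂ) * (u x.1 x.2 * v x.1 x.2) - (m x : ℂ))‖ ≤
      4 • (12000 * δ ^ 3 / (s ^ 2 * t)) := by
    refine (norm_sum_le_of_le _ fun x hx =>
      hu.norm_nbr_sub_le hv hδ hδ1 he hs hst.le hx).trans ?_
    rw [Finset.sum_const]
    exact le_of_eq rfl
  have hmain : ∑ x ∈ nbrs, m x ≤ -(δ ^ 2 * (1 / (4 * (s ^ 2 * t)))) := by
    have h1 := leading_term_le hs' (by linarith : (s : ℝ) ≤ t) he
    have h2 := mul_le_mul_of_nonneg_left h1 (sq_nonneg δ)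
    rw [mul_neg] at h2
    refine le_trans (le_of_eq ?_) h2
    simp only [nbrs, hm]
    rw [Finset.sum_insert (by decide), Finset.sum_insert (by decide),
      Finset.sum_insert (by decide), Finset.sum_singleton]
    push_cast
    ring_nf
  rw [Finset.sum_sub_distrib, ← Complex.ofReal_sum] at hnbr
  have hD : 0 < δ ^ 2 / (s ^ 2 * t) := by positivity
  have hlower : δ ^ 2 / (s ^ 2 * t) / 8 ≤ ‖S‖ := by
    have h1 : ‖((∑ x ∈ nbrs, m x : ℝ) : ℂ)‖ = |∑ x ∈ nbrs, m x| := by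
      rw [Complex.norm_real, Real.norm_eq_abs]
    have h2 : δ ^ 2 / (s ^ 2 * t) / 4 ≤ |∑ x ∈ nbrs, m x| := by
      rw [le_abs]
      right
      refine le_trans (le_of_eq ?_) (le_neg_of_le_neg hmain)
      field_simp
    have h3 : ((∑ x ∈ nbrs, m x : ℝ) : ℂ) = S -
        ∑ x ∈ box L \ nbrs, (x.1 : ℂ) * (u x.1 x.2 * v x.1 x.2) -
        (∑ x ∈ nbrs, (x.1 : ℂ) * (u x.1 x.2 * v x.1 x.2) - ((∑ x ∈ nbrs, m x : ℝ) : ℂ)) := by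
      rw [hS, ← hsplit]; ring
    have h4 : ‖((∑ x ∈ nbrs, m x : ℝ) : ℂ)‖ ≤ ‖S‖ +
        ‖∑ x ∈ box L \ nbrs, (x.1 : ℂ) * (u x.1 x.2 * v x.1 x.2)‖ +
        ‖∑ x ∈ nbrs, (x.1 : ℂ) * (u x.1 x.2 * v x.1 x.2) - ((∑ x ∈ nbrs, m x : ℝ) : ℂ)‖ := by
      conv_lhs => rw [h3]
      exact (norm_sub_le _ _).trans (by gcongr; exact norm_sub_le _ _)
    have h5 : ∀ c : ℝ, c * δ ^ 3 / (s ^ 2 * t) = c * δ * (δ ^ 2 / (s ^ 2 * t)) := by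
      intro c; ring
    rw [h5] at hrest hnbr
    rw [nsmul_eq_mul] at hnbr
    have h6 : δ * (δ ^ 2 / (s ^ 2 * t)) ≤ 1 / 10 ^ 11 * (δ ^ 2 / (s ^ 2 * t)) := by gcongr
    rw [h1] at h4
    push_cast at hnbr h4
    nlinarith
  have hn : (s : ℝ) * (2 * L + 1) ^ 2 * (1 / 4) ^ (2 * L + 1) ≤ 1 := by
    have h1 : ((2 * L + 1 : ℕ) : ℝ) ^ 3 ≤ 4 ^ (2 * L + 1) := by
      exact_mod_cast cube_le_four_pow (2 * L + 1)
    have h2 : (s : ℝ) ≤ ((2 * L + 1 : ℕ) : ℝ) := by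
      have : s ≤ 2 * L + 1 := by omega
      exact_mod_cast this
    rw [one_div, inv_pow, ← div_eq_mul_inv, div_le_one (by positivity)]
    refine le_trans ?_ h1
    calc (s : ℝ) * (2 * L + 1) ^ 2 ≤ ((2 * L + 1 : ℕ) : ℝ) * (2 * L + 1) ^ 2 := by gcongr
      _ = _ := by push_cast; ring
  have h1 : δ ^ 2 / (s ^ 2 * t) / 4 ≤ 2 * |(t : ℝ) - s| * ‖S‖ := by
    have : 1 ≤ |(t : ℝ) - s| := by rw [le_abs]; left; linarith
    nlinarith [norm_nonneg S]
  have h2 : 8 * (2 * L + 1) ^ 2 * δ * (5000 ^ 2 * δ ^ 2 * (1 / 4) ^ (2 * L + 1) / (s * t)) =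
      2 * 10 ^ 8 * δ * (δ ^ 2 / (s ^ 2 * t)) * (s * (2 * L + 1) ^ 2 * (1 / 4) ^ (2 * L + 1)) := by
    field_simp
    ring
  have h3 := h1.trans hupper
  rw [h2] at h3
  have h4 : 2 * 10 ^ 8 * δ * (δ ^ 2 / (s ^ 2 * t)) *
      (s * (2 * L + 1) ^ 2 * (1 / 4) ^ (2 * L + 1)) ≤
      2 * 10 ^ 8 * δ * (δ ^ 2 / (s ^ 2 * t)) * 1 := by gcongr
  have h6 : δ * (δ ^ 2 / (s ^ 2 * t)) ≤ 1 / 10 ^ 11 * (δ ^ 2 / (s ^ 2 * t)) := by gcongr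
  linarith

end IsLocalSol

/-- The eigenvalue equation `H f = E f` in curried form. -/
def IsEigen (δ E : ℝ) (f : ℤ → ℤ → ℂ) : Prop :=
  ∀ a b : ℤ, ((((b + a ^ 2 : ℤ) : ℝ) - E : ℝ) : ℂ) * f a b + δ * hop f a b = 0

/-- If the energy is close to the one of the resonant sites `(0, 0)`, `(±1, -1)`, then the values
there are controlled by the values nearby. -/
theorem IsEigen.cluster_le {δ e M : ℝ} {w : ℤ → ℤ → ℂ} (h : IsEigen δ e w) (hδ : 0 < δ)
    (hδ' : δ ≤ 1 / 10 ^ 11) (he : |e| ≤ δ ^ 2 / 10) (h0 : ‖w 0 0‖ ≤ M)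
    (h1 : ‖w 1 (-1)‖ ≤ M)
    (hle : ∀ a b : ℤ, ‖w a b‖ ≤ 16 * 2 ^ supNorm a b * M) :
    ‖w 0 0‖ ≤ M / 8 ∧ ‖w 1 (-1)‖ ≤ M / 8 ∧ ‖w (-1) (-1)‖ ≤ M / 8 := by
  have hM : 0 ≤ M := (norm_nonneg _).trans h0
  have he1 : |e| ≤ 1 / 8 := he.trans (by nlinarith)
  have hδM : 0 ≤ δ * M := by positivity
  set B := 2048 * (δ * M) with hB
  have hsmall : ∀ a b : ℤ, supNorm a b ≤ 3 → b + a ^ 2 ≠ 0 → ‖w a b‖ ≤ B := by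
    intro a b hab hne
    have h3 := norm_le_of_eq hδ.le (by norm_num : (0 : ℝ) < 1 / 2)
      (one_half_le_abs_sub he1 hne) (h a b)
    have h4 : ‖hop w a b‖ ≤ 4 * (16 * 2 ^ 4 * M) := by
      refine norm_hop_le fun c d hc hd => (hle _ _).trans ?_
      have := (supNorm_add_le (a := a) (b := b) hc hd).1
      have : (2 : ℝ) ^ supNorm (a + c) (b + d) ≤ 2 ^ 4 :=
        pow_le_pow_right₀ (by norm_num) (by omega)
      gcongr
    calc ‖w a b‖ ≤ δ / (1 / 2) * ‖hop w a b‖ := h3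
      _ ≤ δ / (1 / 2) * (4 * (16 * 2 ^ 4 * M)) := by gcongr
      _ = B := by rw [hB]; ring
  have eqs : ∀ a b : ℤ, ((b + a ^ 2 : ℂ) - e) * w a b + δ * (w (a + 1) (b + 1) +
      w (a + 1) (b - 1) + w (a - 1) (b + 1) + w (a - 1) (b - 1)) = 0 := by
    intro a b
    have := h a b
    push_cast [hop] at this
    exact this
  have q0 := eqs 0 0
  have q1 := eqs 1 (-1)
  have q2 := eqs (-1) (-1)
  have q3 := eqs 2 0
  have q4 := eqs (-2) 0
  have q5 := eqs 2 (-2)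
  have q6 := eqs (-2) (-2)
  norm_num at q0 q1 q2 q3 q4 q5 q6
  obtain ⟨hel, her⟩ := abs_le.1 he1
  set D := w 1 (-1) - w (-1) (-1) with hD
  set r₁ := w 3 1 + w 3 (-1) + w 1 1 - (w (-1) 1 + w (-3) 1 + w (-3) (-1)) with hr₁
  set r₂ := w 3 (-1) + w 3 (-3) + w 1 (-3) - (w (-1) (-3) + w (-3) (-1) + w (-3) (-3)) with hr₂
  have n31 := hsmall 3 1 (by decide) (by decide)
  have n31' := hsmall 3 (-1) (by decide) (by decide)
  have n11 := hsmall 1 1 (by decide) (by decide)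
  have n11' := hsmall (-1) 1 (by decide) (by decide)
  have n31'' := hsmall (-3) 1 (by decide) (by decide)
  have n31''' := hsmall (-3) (-1) (by decide) (by decide)
  have n33 := hsmall 3 (-3) (by decide) (by decide)
  have n33' := hsmall (-3) (-3) (by decide) (by decide)
  have n13 := hsmall 1 (-3) (by decide) (by decide)
  have n13' := hsmall (-1) (-3) (by decide) (by decide)
  have n20 := hsmall 2 0 (by decide) (by decide)
  have n22 := hsmall 2 (-2) (by decide) (by decide)
  have n02 := hsmall 0 (-2) (by decide) (by decide)
  have hr₁' : ‖r₁‖ ≤ 6 * B := by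
    have a1 := norm_sub_le (w 3 1 + w 3 (-1) + w 1 1) (w (-1) 1 + w (-3) 1 + w (-3) (-1))
    have a2 := norm_add₃_le (a := w 3 1) (b := w 3 (-1)) (c := w 1 1)
    have a3 := norm_add₃_le (a := w (-1) 1) (b := w (-3) 1) (c := w (-3) (-1))
    linarith
  have hr₂' : ‖r₂‖ ≤ 6 * B := by
    have a1 := norm_sub_le (w 3 (-1) + w 3 (-3) + w 1 (-3)) (w (-1) (-3) + w (-3) (-1) + w (-3) (-3))
    have a2 := norm_add₃_le (a := w 3 (-1)) (b := w 3 (-3)) (c := w 1 (-3))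
    have a3 := norm_add₃_le (a := w (-1) (-3)) (b := w (-3) (-1)) (c := w (-3) (-3))
    linarith
  have c4 : (0 : ℝ) < 4 - e := by linarith
  have c2 : (0 : ℝ) < 2 - e := by linarith
  have c4' : ((4 : ℂ) - e) ≠ 0 := by exact_mod_cast c4.ne'
  have c2' : ((2 : ℂ) - e) ≠ 0 := by exact_mod_cast c2.ne'
  have key : ((δ ^ 2 * (1 / (4 - e) + 1 / (2 - e)) + e : ℝ) : ℂ) * D +
      ((δ ^ 2 : ℝ) : ℂ) * (r₁ / (4 - e) + r₂ / (2 - e)) = 0 := by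
    have hA : (w 2 0 - w (-2) 0) = -(δ * (D + r₁)) / (4 - e) := by
      rw [eq_div_iff c4', hD, hr₁]
      linear_combination q3 - q4
    have hA' : (w 2 (-2) - w (-2) (-2)) = -(δ * (D + r₂)) / (2 - e) := by
      rw [eq_div_iff c2', hD, hr₂]
      linear_combination q5 - q6
    have h3 : (e : ℂ) * D = δ * ((w 2 0 - w (-2) 0) + (w 2 (-2) - w (-2) (-2))) := by
      rw [hD]
      linear_combination q2 - q1
    rw [hA, hA'] at h3
    push_cast
    linear_combination h3
  have hcoef : δ ^ 2 / 2 ≤ |δ ^ 2 * (1 / (4 - e) + 1 / (2 - e)) + e| := by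
    rw [le_abs]
    left
    have b1 : (6 : ℝ) / 25 ≤ 1 / (4 - e) := by rw [div_le_div_iff₀ (by norm_num) c4]; linarith
    have b2 : (2 : ℝ) / 5 ≤ 1 / (2 - e) := by rw [div_le_div_iff₀ (by norm_num) c2]; linarith
    have := (abs_le.1 he).1
    nlinarith [sq_nonneg δ]
  have hDle : ‖D‖ ≤ 24 * B := by
    have h3 := norm_le_of_eq (sq_nonneg δ) (by positivity) hcoef key
    have h4 : ‖r₁ / (4 - e) + r₂ / (2 - e)‖ ≤ 12 * B := by
      have b1 : ‖r₁ / (4 - e)‖ ≤ ‖r₁‖ := by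
        have : ‖(4 : ℂ) - e‖ = 4 - e := by
          rw [show (4 : ℂ) - e = ((4 - e : ℝ) : ℂ) by push_cast; rfl, Complex.norm_real,
            Real.norm_eq_abs, abs_of_pos c4]
        rw [norm_div, this]
        exact div_le_self (norm_nonneg _) (by linarith)
      have b2 : ‖r₂ / (2 - e)‖ ≤ ‖r₂‖ := by
        have : ‖(2 : ℂ) - e‖ = 2 - e := by
          rw [show (2 : ℂ) - e = ((2 - e : ℝ) : ℂ) by push_cast; rfl, Complex.norm_real,
            Real.norm_eq_abs, abs_of_pos c2]
        rw [norm_div, this]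
        exact div_le_self (norm_nonneg _) (by linarith)
      have := norm_add_le (r₁ / (4 - e)) (r₂ / (2 - e))
      linarith
    calc ‖D‖ ≤ δ ^ 2 / (δ ^ 2 / 2) * ‖r₁ / (4 - e) + r₂ / (2 - e)‖ := h3
      _ ≤ δ ^ 2 / (δ ^ 2 / 2) * (12 * B) := by gcongr
      _ = 24 * B := by field_simp; ring
  have hδc : (δ : ℂ) ≠ 0 := by exact_mod_cast hδ.ne'
  have hdiv : ∀ z : ℂ, ‖z‖ ≤ M → ∃ y : ℂ, e * z = δ * y ∧ ‖y‖ ≤ B := by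
    intro z hz
    refine ⟨(e / δ : ℝ) * z, ?_, ?_⟩
    · push_cast
      field_simp
    · rw [norm_mul, Complex.norm_real, Real.norm_eq_abs, abs_div, abs_of_pos hδ]
      have : |e| / δ ≤ δ := by rw [div_le_iff₀ hδ]; nlinarith
      calc |e| / δ * ‖z‖ ≤ δ * M := by gcongr
        _ ≤ B := by rw [hB]; linarith
  obtain ⟨y0, hy0, hy0'⟩ := hdiv _ h0
  obtain ⟨y1, hy1, hy1'⟩ := hdiv _ h1
  have hS : ‖w 1 (-1) + w (-1) (-1)‖ ≤ 3 * B := by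
    have h3 : w 1 (-1) + w (-1) (-1) = y0 - (w 1 1 + w (-1) 1) := by
      apply mul_left_cancel₀ hδc
      linear_combination q0 + hy0
    rw [h3]
    have a1 := norm_sub_le y0 (w 1 1 + w (-1) 1)
    have a2 := norm_add_le (w 1 1) (w (-1) 1)
    linarith
  have hw1 : ‖w 1 (-1)‖ ≤ 27 * B := by
    have h3 : w 1 (-1) + w 1 (-1) = (w 1 (-1) + w (-1) (-1)) + D := by rw [hD]; ring
    have h4 : ‖w 1 (-1) + w 1 (-1)‖ = 2 * ‖w 1 (-1)‖ := by rw [← two_mul, norm_mul]; simp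
    have := norm_add_le (w 1 (-1) + w (-1) (-1)) D
    rw [← h3, h4] at this
    linarith [norm_nonneg (w 1 (-1))]
  have hw2 : ‖w (-1) (-1)‖ ≤ 27 * B := by
    have h3 : w (-1) (-1) + w (-1) (-1) = (w 1 (-1) + w (-1) (-1)) - D := by rw [hD]; ring
    have h4 : ‖w (-1) (-1) + w (-1) (-1)‖ = 2 * ‖w (-1) (-1)‖ := by
      rw [← two_mul, norm_mul]; simp
    have := norm_sub_le (w 1 (-1) + w (-1) (-1)) D
    rw [← h3, h4] at this
    linarith [norm_nonneg (w (-1) (-1))]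
  have hw0 : ‖w 0 0‖ ≤ 27 * B := by
    have h3 : w 0 0 = y1 - (w 2 0 + w 2 (-2) + w 0 (-2)) := by
      apply mul_left_cancel₀ hδc
      linear_combination q1 + hy1
    rw [h3]
    have a1 := norm_sub_le y1 (w 2 0 + w 2 (-2) + w 0 (-2))
    have a2 := norm_add₃_le (a := w 2 0) (b := w 2 (-2)) (c := w 0 (-2))
    linarith [norm_nonneg y1]
  have hfin : 27 * B ≤ M / 8 := by rw [hB]; nlinarith
  exact ⟨hw0.trans hfin, hw1.trans hfin, hw2.trans hfin⟩

theorem supNorm_sub_comm (a b c d : ℤ) : supNorm (a - c) (b - d) = supNorm (c - a) (d - b) := by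
  unfold supNorm; omega

theorem supNorm_sub_le (a b c d p q : ℤ) :
    supNorm (a - p) (b - q) ≤ supNorm (a - c) (b - d) + supNorm (c - p) (d - q) := by
  unfold supNorm; omega

/-- The value of `f` at `(a, b)` is dominated, with exponential gain, by a value elsewhere. -/
def IsDominated (f : ℤ → ℤ → ℂ) (a b : ℤ) : Prop :=
  ∃ c d : ℤ, 1 ≤ supNorm (a - c) (b - d) ∧
    ‖f a b‖ ≤ (1 / 2) ^ supNorm (a - c) (b - d) * ‖f c d‖

theorem of_not_isDominated {f : ℤ → ℤ → ℂ} {a b : ℤ} (h : ¬IsDominated f a b) :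
    f a b ≠ 0 ∧ ∀ c d : ℤ, ‖f c d‖ ≤ 2 ^ supNorm (c - a) (d - b) * ‖f a b‖ := by
  unfold IsDominated at h
  push Not at h
  constructor
  · intro h0
    have := h (a + 1) b (by unfold supNorm; omega)
    rw [h0, norm_zero] at this
    exact absurd this (not_lt.2 (by positivity))
  · intro c d
    by_cases h1 : 1 ≤ supNorm (a - c) (b - d)
    · have h2 := (h c d h1).le
      rw [supNorm_sub_comm c d a b]
      rw [one_div, inv_pow, inv_mul_le_iff₀ (by positivity)] at h2
      exact h2
    · have h2 : c = a ∧ d = b := by unfold supNorm at h1; omega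
      rw [h2.1, h2.2]
      simp [supNorm]

theorem exists_decay {f : ℤ → ℤ → ℂ} {Z : ℤ → ℤ → Prop} (hZ : ∃ a b, Z a b)
    (hf : ∀ a b, ‖f a b‖ ≤ 1) (h : ∀ a b, ¬Z a b → IsDominated f a b) (a b : ℤ) :
    ∃ c d, Z c d ∧ ‖f a b‖ ≤ (1 / 2) ^ supNorm (a - c) (b - d) := by
  have key : ∀ n : ℕ, ∀ a b, (∃ c d, Z c d ∧ ‖f a b‖ ≤ (1 / 2) ^ supNorm (a - c) (b - d)) ∨
      ‖f a b‖ ≤ (1 / 2) ^ n := by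
    intro n
    induction n with
    | zero => intro a b; right; simpa using hf a b
    | succ n ih =>
      intro a b
      by_cases hab : Z a b
      · exact Or.inl ⟨a, b, hab, by simpa [supNorm] using hf a b⟩
      obtain ⟨c, d, hcd, hle⟩ := h a b hab
      rcases ih c d with ⟨p, q, hpq, hle'⟩ | hle'
      · refine Or.inl ⟨p, q, hpq, hle.trans ?_⟩
        calc _ ≤ (1 / 2 : ℝ) ^ supNorm (a - c) (b - d) * (1 / 2) ^ supNorm (c - p) (d - q) := by
              gcongr
          _ ≤ _ := by
              rw [← pow_add]
              exact pow_le_pow_of_le_one (by norm_num) (by norm_num) (supNorm_sub_le ..)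
      · refine Or.inr (hle.trans ?_)
        calc _ ≤ (1 / 2 : ℝ) ^ 1 * (1 / 2) ^ n := by
              gcongr ?_ * ?_
              exact pow_le_pow_of_le_one (by norm_num) (by norm_num) hcd
          _ = _ := by ring
  by_cases h0 : f a b = 0
  · obtain ⟨c, d, hcd⟩ := hZ
    exact ⟨c, d, hcd, by rw [h0, norm_zero]; positivity⟩
  · obtain ⟨n, hn⟩ := exists_pow_lt_of_lt_one (norm_pos_iff.2 h0) (by norm_num : (1 / 2 : ℝ) < 1)
    exact (key n a b).resolve_right (not_le.2 hn)

namespace IsEigen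

variable {δ E : ℝ} {f : ℤ → ℤ → ℂ} {m : ℤ}

theorem isDominated_of_ne (h : IsEigen δ E f) (hδ : 0 < δ) (hδ' : δ ≤ 1 / 10 ^ 11)
    (he : |E - m| ≤ 1 / 8) {a b : ℤ} (hab : b + a ^ 2 ≠ m) : IsDominated f a b := by
  by_contra hcon
  obtain ⟨h0, hle⟩ := of_not_isDominated hcon
  have hlow : 1 / 2 ≤ |((b + a ^ 2 : ℤ) : ℝ) - E| := by
    have := one_half_le_abs_sub he (sub_ne_zero.2 hab)
    push_cast at this ⊢
    rwa [show (b : ℝ) + a ^ 2 - m - (E - m) = b + a ^ 2 - E by ring] at this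
  have h1 := norm_le_of_eq hδ.le (by norm_num) hlow (h a b)
  have h2 : ‖hop f a b‖ ≤ 4 * (2 ^ 1 * ‖f a b‖) := by
    refine norm_hop_le fun c d hc hd => ?_
    have := hle (a + c) (b + d)
    have h3 : supNorm (a + c - a) (b + d - b) = 1 := by unfold supNorm; omega
    rwa [h3] at this
  have h3 : 0 < ‖f a b‖ := norm_pos_iff.2 h0
  have h4 : ‖f a b‖ ≤ δ / (1 / 2) * (4 * (2 ^ 1 * ‖f a b‖)) := h1.trans (by gcongr)
  nlinarith

/-- Recentring at a resonant site. -/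
theorem exists_isLocalSol (h : IsEigen δ E f) {k n : ℤ} (hm : n + k ^ 2 = m) (h0 : f k n ≠ 0)
    (hle : ∀ c d : ℤ, ‖f c d‖ ≤ 2 ^ supNorm (c - k) (d - n) * ‖f k n‖) :
    ∃ u, IsLocalSol δ (E - m) k.natAbs u := by
  obtain ⟨σ, hσ, hk⟩ : ∃ σ : ℤ, (σ = 1 ∨ σ = -1) ∧ k = σ * k.natAbs := by
    rcases le_total 0 k with hk | hk
    · exact ⟨1, Or.inl rfl, by omega⟩
    · exact ⟨-1, Or.inr rfl, by omega⟩
  have hσ2 : σ ^ 2 = 1 := by rcases hσ with rfl | rfl <;> norm_num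
  refine ⟨fun a b => if (a + b) % 2 = 0 then f (k + σ * a) (n + b) / f k n else 0, ?_, ?_, ?_, ?_⟩
  · intro a b
    by_cases hab : (a + b) % 2 = 0
    · have h1 : hop (fun a b => if (a + b) % 2 = 0 then f (k + σ * a) (n + b) / f k n else 0) a b =
          hop f (k + σ * a) (n + b) / f k n := by
        simp only [hop]
        rw [if_pos (by omega), if_pos (by omega), if_pos (by omega), if_pos (by omega)]
        rcases hσ with rfl | rfl
        · simp only [one_mul, add_assoc, add_sub_assoc]
          ring
        · rw [show k + -1 * (a + 1) = k + -1 * a - 1 by ring,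
            show k + -1 * (a - 1) = k + -1 * a + 1 by ring]
          simp only [add_assoc, add_sub_assoc]
          ring
      rw [h1, if_pos hab]
      have h2 := h (k + σ * a) (n + b)
      have h3 : (n + b) + (k + σ * a) ^ 2 = m + (b + a ^ 2 + 2 * k.natAbs * a) := by
        have h4 : σ * k = k.natAbs := by
          conv_lhs => rw [hk]
          linear_combination (k.natAbs : ℤ) * hσ2
        linear_combination hm + 2 * a * h4 + a ^ 2 * hσ2
      rw [h3] at h2
      field_simp
      push_cast at h2 ⊢
      linear_combination h2
    · have h1 : hop (fun a b => if (a + b) % 2 = 0 then f (k + σ * a) (n + b) / f k n else 0) a b =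
          0 := by
        simp only [hop]
        rw [if_neg (by omega), if_neg (by omega), if_neg (by omega), if_neg (by omega)]
        ring
      rw [h1, if_neg hab]
      ring
  · simp [h0]
  · intro a b hab
    exact if_neg hab
  · intro a b
    by_cases hab : (a + b) % 2 = 0
    · rw [if_pos hab, norm_div, div_le_iff₀ (norm_pos_iff.2 h0)]
      have h1 : supNorm (k + σ * a - k) (n + b - n) = supNorm a b := by
        rcases hσ with rfl | rfl <;> unfold supNorm <;> omega
      exact h1 ▸ hle (k + σ * a) (n + b)
    · rw [if_neg hab, norm_zero]
      positivity

theorem shift (h : IsEigen δ E f) (m : ℤ) : IsEigen δ (E - m) (fun a b => f a (m + b)) := by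
  intro a b
  have h1 := h a (m + b)
  simp only [hop, add_assoc, add_sub_assoc] at h1 ⊢
  push_cast at h1 ⊢
  linear_combination h1

/-- At energies of order `δ² / 10` the three central resonant sites cannot dominate. -/
theorem cluster_not_max (h : IsEigen δ E f) (hδ : 0 < δ) (hδ' : δ ≤ 1 / 10 ^ 11)
    (he : |E - m| ≤ δ ^ 2 / 10) {k n : ℤ} (hm : n + k ^ 2 = m) (hk : k.natAbs ≤ 1)
    (h0 : f k n ≠ 0) :
    ¬∀ c d : ℤ, ‖f c d‖ ≤ 2 ^ supNorm (c - k) (d - n) * ‖f k n‖ := by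
  intro hle
  have hpos : 0 < ‖f k n‖ := norm_pos_iff.2 h0
  have hk' : k = 0 ∨ k = 1 ∨ k = -1 := by omega
  have hn : (k = 0 ∧ n = m) ∨ ((k = 1 ∨ k = -1) ∧ n = m - 1) := by
    rcases hk' with rfl | rfl | rfl
    · left; constructor <;> linarith
    · right; exact ⟨Or.inl rfl, by linarith⟩
    · right; exact ⟨Or.inr rfl, by linarith⟩
  have hb : ∀ a b : ℤ, ‖f a (m + b)‖ ≤ 2 ^ (supNorm a b + 1) * ‖f k n‖ := by
    intro a b
    refine (hle a (m + b)).trans ?_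
    gcongr
    · norm_num
    · unfold supNorm; omega
  have hb' : ∀ a b : ℤ, supNorm a b ≤ 1 → ‖f a (m + b)‖ ≤ 4 * ‖f k n‖ := by
    intro a b hab
    refine (hb a b).trans ?_
    have : (2 : ℝ) ^ (supNorm a b + 1) ≤ 2 ^ 2 := pow_le_pow_right₀ (by norm_num) (by omega)
    calc _ ≤ (2 : ℝ) ^ 2 * ‖f k n‖ := by gcongr
      _ = _ := by norm_num
  obtain ⟨r0, r1, r2⟩ := (h.shift m).cluster_le hδ hδ' he (M := 4 * ‖f k n‖)
    (hb' 0 0 (by decide)) (hb' 1 (-1) (by decide)) (by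
      intro a b
      refine (hb a b).trans ?_
      rw [pow_succ]
      have : 0 ≤ (2 : ℝ) ^ supNorm a b * ‖f k n‖ := by positivity
      linarith)
  have : ‖f k n‖ ≤ 4 * ‖f k n‖ / 8 := by
    rcases hn with ⟨rfl, rfl⟩ | ⟨rfl | rfl, rfl⟩
    · simpa using r0
    · exact r1
    · exact r2
  linarith

end IsEigen

theorem half_pow_eq_exp (d : ℕ) : (1 / 2 : ℝ) ^ d = Real.exp (-(Real.log 2 * d)) := by
  rw [Real.exp_neg, mul_comm, Real.exp_nat_mul, Real.exp_log (by norm_num), one_div, inv_pow]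

theorem exists_forall_norm_le {φ : ℤ × ℤ → ℂ} (h : Summable fun p => ‖φ p‖ ^ 2)
    (h1 : ∑' p, ‖φ p‖ ^ 2 = 1) : ∃ x, φ x ≠ 0 ∧ ∀ y, ‖φ y‖ ≤ ‖φ x‖ := by
  obtain ⟨p, hp⟩ : ∃ p, φ p ≠ 0 := by
    by_contra! hcon
    simp [hcon] at h1
  have hfin : {y | ‖φ p‖ ^ 2 ≤ ‖φ y‖ ^ 2}.Finite := by
    have := h.tendsto_cofinite_zero.eventually_lt_const
      (show (0 : ℝ) < ‖φ p‖ ^ 2 by have := norm_pos_iff.2 hp; positivity)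
    rw [Filter.eventually_cofinite] at this
    simpa using this
  obtain ⟨x, hx, hmax⟩ := Set.exists_max_image _ (fun y => ‖φ y‖) hfin ⟨p, le_refl (‖φ p‖ ^ 2)⟩
  have hpx : ‖φ p‖ ≤ ‖φ x‖ := hmax p (le_refl (‖φ p‖ ^ 2))
  refine ⟨x, norm_pos_iff.1 ((norm_pos_iff.2 hp).trans_le hpx), fun y => ?_⟩
  by_cases hy : ‖φ p‖ ^ 2 ≤ ‖φ y‖ ^ 2
  · exact hmax y hy
  · have := lt_of_pow_lt_pow_left₀ 2 (norm_nonneg _) (not_le.1 hy)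
    linarith

theorem isEigen_of_Hfl {δ E : ℝ} {φ : ℤ × ℤ → ℂ} (h : ∀ p : ℤ × ℤ, Hfl δ φ p = (E : ℂ) * φ p) :
    IsEigen δ E fun a b => φ (a, b) := by
  intro a b
  have := h (a, b)
  simp only [Hfl, hop] at this ⊢
  push_cast at this ⊢
  linear_combination this

namespace IsEigen

variable {δ E : ℝ} {f : ℤ → ℤ → ℂ} {m k n : ℤ}

/-- The energy is close to the diagonal entry at a maximum of `|f|`. -/
theorem abs_sub_le_of_max (h : IsEigen δ E f) (hδ : 0 < δ) (hm : n + k ^ 2 = m) (h0 : f k n ≠ 0)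
    (hmax : ∀ c d, ‖f c d‖ ≤ ‖f k n‖) : |E - m| ≤ 4 * δ := by
  have h1 := h k n
  rw [hm] at h1
  have h2 : ‖hop f k n‖ ≤ 4 * ‖f k n‖ := norm_hop_le fun _ _ _ _ => hmax _ _
  have h3 : ((((m : ℝ) - E : ℝ) : ℂ)) * f k n = -(δ * hop f k n) := by linear_combination h1
  have h4 : |(m : ℝ) - E| * ‖f k n‖ = δ * ‖hop f k n‖ := by
    have := congrArg norm h3
    rwa [norm_neg, norm_mul, norm_mul, Complex.norm_real, Complex.norm_real, Real.norm_eq_abs,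
      Real.norm_eq_abs, abs_of_pos hδ] at this
  rw [abs_sub_comm]
  refine le_of_mul_le_mul_right ?_ (norm_pos_iff.2 h0)
  rw [h4]
  nlinarith

theorem le_two_pow_of_max (hmax : ∀ c d, ‖f c d‖ ≤ ‖f k n‖) (c d : ℤ) :
    ‖f c d‖ ≤ 2 ^ supNorm (c - k) (d - n) * ‖f k n‖ :=
  (hmax c d).trans (le_mul_of_one_le_left (norm_nonneg _) (one_le_pow₀ (by norm_num)))

/-- Resonant sites with a different `|j|` than the maximum are dominated. -/
theorem isDominated_of_natAbs_ne (h : IsEigen δ E f) (hδ : 0 < δ) (hδ' : δ ≤ 1 / 10 ^ 11)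
    (he : |E - m| ≤ 1 / 8) (hm : n + k ^ 2 = m) (h0 : f k n ≠ 0)
    (hmax : ∀ c d, ‖f c d‖ ≤ ‖f k n‖) (hk : 2 ≤ k.natAbs) {a b : ℤ} (hab : b + a ^ 2 = m)
    (ha : 2 ≤ a.natAbs) (hne : a.natAbs ≠ k.natAbs) : IsDominated f a b := by
  by_contra hcon
  obtain ⟨h1, hle⟩ := of_not_isDominated hcon
  obtain ⟨u, hu⟩ := h.exists_isLocalSol hm h0 (le_two_pow_of_max hmax)
  obtain ⟨v, hv⟩ := h.exists_isLocalSol hab h1 hle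
  rcases lt_or_gt_of_ne hne with hlt | hlt
  · exact hv.not_lt hu hδ hδ' he ha hlt
  · exact hu.not_lt hv hδ hδ' he hk hlt

theorem abs_sub_le_sq (h : IsEigen δ E f) (hδ : 0 < δ) (hδ' : δ ≤ 1 / 10 ^ 11)
    (he : |E - m| ≤ 1 / 8) (hm : n + k ^ 2 = m) (h0 : f k n ≠ 0)
    (hle : ∀ c d : ℤ, ‖f c d‖ ≤ 2 ^ supNorm (c - k) (d - n) * ‖f k n‖)
    (hk : 50000 ≤ k.natAbs) : |E - m| ≤ δ ^ 2 / 10 := by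
  obtain ⟨u, hu⟩ := h.exists_isLocalSol hm h0 hle
  refine (hu.abs_energy_le hδ (hδ'.trans (by norm_num)) he (by omega)).trans ?_
  have : (50000 : ℝ) ≤ k.natAbs := by exact_mod_cast hk
  rw [div_le_div_iff₀ (by linarith) (by norm_num)]
  nlinarith [sq_nonneg δ]

/-- If the maximum is far from the axis `j = 0`, all sites but it and its mirror image are
dominated. -/
theorem isDominated_of_far (h : IsEigen δ E f) (hδ : 0 < δ) (hδ' : δ ≤ 1 / 10 ^ 11)
    (he : |E - m| ≤ 1 / 8) (hm : n + k ^ 2 = m) (h0 : f k n ≠ 0)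
    (hmax : ∀ c d, ‖f c d‖ ≤ ‖f k n‖) (hk : 50000 ≤ k.natAbs) {a b : ℤ}
    (hab : ¬(a.natAbs = k.natAbs ∧ b = n)) : IsDominated f a b := by
  by_cases hr : b + a ^ 2 = m
  swap
  · exact h.isDominated_of_ne hδ hδ' he hr
  have hne : a.natAbs ≠ k.natAbs := by
    intro heq
    have := Int.natAbs_eq_iff_sq_eq.1 heq
    exact hab ⟨heq, by linarith⟩
  by_cases ha : 2 ≤ a.natAbs
  · exact h.isDominated_of_natAbs_ne hδ hδ' he hm h0 hmax (by omega) hr ha hne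
  · by_contra hcon
    obtain ⟨h1, hle⟩ := of_not_isDominated hcon
    exact h.cluster_not_max hδ hδ'
      (h.abs_sub_le_sq hδ hδ' he hm h0 (le_two_pow_of_max hmax) hk) hr (by omega) h1 hle

/-- If the maximum is near the axis `j = 0`, all sites but the resonant ones near the axis are
dominated. -/
theorem isDominated_of_near (h : IsEigen δ E f) (hδ : 0 < δ) (hδ' : δ ≤ 1 / 10 ^ 11)
    (he : |E - m| ≤ 1 / 8) (hm : n + k ^ 2 = m) (h0 : f k n ≠ 0)
    (hmax : ∀ c d, ‖f c d‖ ≤ ‖f k n‖) (hk : k.natAbs < 50000) {a b : ℤ}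
    (hab : ¬(a.natAbs < 50000 ∧ b + a ^ 2 = m)) : IsDominated f a b := by
  by_cases hr : b + a ^ 2 = m
  swap
  · exact h.isDominated_of_ne hδ hδ' he hr
  have ha : 50000 ≤ a.natAbs := by
    by_contra hcon
    exact hab ⟨by omega, hr⟩
  by_cases hk2 : 2 ≤ k.natAbs
  · exact h.isDominated_of_natAbs_ne hδ hδ' he hm h0 hmax hk2 hr (by omega) (by omega)
  · by_contra hcon
    obtain ⟨h1, hle⟩ := of_not_isDominated hcon
    exact h.cluster_not_max hδ hδ' (h.abs_sub_le_sq hδ hδ' he hr h1 hle ha) hm (by omega) h0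
      (le_two_pow_of_max hmax)

end IsEigen

theorem half_pow_supNorm_le_exp_dist1 (a b c d : ℤ) :
    (1 / 2 : ℝ) ^ supNorm (a - c) (b - d) ≤
      Real.exp (-(Real.log 2 / 2) * (dist1 (a, b) (c, d) : ℤ)) := by
  rw [half_pow_eq_exp]
  apply Real.exp_le_exp.2
  have h1 : dist1 (a, b) (c, d) ≤ 2 * supNorm (a - c) (b - d) := by
    simp only [dist1, supNorm, Int.abs_eq_natAbs]; omega
  have h2 : ((dist1 (a, b) (c, d) : ℤ) : ℝ) ≤ 2 * supNorm (a - c) (b - d) := by exact_mod_cast h1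
  have := Real.log_pos (by norm_num : (1 : ℝ) < 2)
  nlinarith

theorem half_pow_supNorm_le_exp_near {E : ℝ} {a b l n m : ℤ} (he : |E - m| ≤ 1 / 8)
    (hl : l.natAbs < 50000) (hm : n + l ^ 2 = m) :
    (1 / 2 : ℝ) ^ supNorm (a - l) (b - n) ≤ Real.exp ((50000 + 50000 ^ 2 + 2) / 4) *
      Real.exp (-(((|a| + |b - ⌊E⌋| : ℤ) : ℝ) / 4)) := by
  obtain ⟨h1, h2⟩ := abs_le.1 he
  have hf1 : ⌊E⌋ ≤ m := by
    have : (⌊E⌋ : ℝ) < ((m + 1 : ℤ) : ℝ) := by push_cast; linarith [Int.floor_le E]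
    have : ⌊E⌋ < m + 1 := by exact_mod_cast this
    omega
  have hf2 : m - 1 ≤ ⌊E⌋ := Int.le_floor.2 (by push_cast; linarith)
  have hl2 : l ^ 2 ≤ 50000 ^ 2 := by
    have := abs_lt.1 (show |l| < 50000 by rw [Int.abs_eq_natAbs]; omega)
    nlinarith
  have hl0 := sq_nonneg l
  have hd : |a| + |b - ⌊E⌋| ≤ 2 * supNorm (a - l) (b - n) + (50000 + 50000 ^ 2 + 2) := by
    rw [Int.abs_eq_natAbs, Int.abs_eq_natAbs]
    unfold supNorm
    omega
  have hd' : ((|a| + |b - ⌊E⌋| : ℤ) : ℝ) ≤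
      2 * supNorm (a - l) (b - n) + (50000 + 50000 ^ 2 + 2) := by
    have := (Int.cast_le (R := ℝ)).2 hd
    push_cast at this ⊢
    linarith
  rw [half_pow_eq_exp, ← Real.exp_add]
  apply Real.exp_le_exp.2
  have := Real.log_two_gt_d9
  have : (0 : ℝ) ≤ supNorm (a - l) (b - n) := Nat.cast_nonneg _
  nlinarith

/-- Theorem 1: localization of eigenfunctions of the Floquet Hamiltonian. -/
theorem floquet_eigenfunction_localization :
    ∃ δ₀ > (0 : ℝ), ∃ K > (0 : ℝ), ∃ c > (0 : ℝ), ∃ C > (0 : ℝ),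
      ∀ δ : ℝ, 0 < δ → δ < δ₀ →
      ∀ (φ : ℤ × ℤ → ℂ) (E : ℝ),
        Memℓp φ 2 → (∑' p : ℤ × ℤ, ‖φ p‖ ^ 2) = 1 →
        (∀ p : ℤ × ℤ, Hfl δ φ p = (E : ℂ) * φ p) →
        ((∀ p : ℤ × ℤ,
            ‖φ p‖ ≤ C * Real.exp (-(((|p.1| + |p.2 - ⌊E⌋| : ℤ) : ℝ) / K))) ∨
         (∃ x₁ x₂ : ℤ × ℤ,
            (K ≤ |(x₁.2 : ℝ) - E| ∧ |((x₁.2 + x₁.1 ^ 2 : ℤ) : ℝ) - E| ≤ 2 * δ) ∧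
            (K ≤ |(x₂.2 : ℝ) - E| ∧ |((x₂.2 + x₂.1 ^ 2 : ℤ) : ℝ) - E| ≤ 2 * δ) ∧
            ∀ x : ℤ × ℤ,
              ‖φ x‖ ≤ C * (Real.exp (-c * ((dist1 x x₁ : ℤ) : ℝ)) +
                           Real.exp (-c * ((dist1 x x₂ : ℤ) : ℝ))))) := by
  refine ⟨1 / 10 ^ 11, by norm_num, 4, by norm_num, Real.log 2 / 2,
    half_pos (Real.log_pos (by norm_num)), Real.exp ((50000 + 50000 ^ 2 + 2) / 4),
    Real.exp_pos _, ?_⟩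
  intro δ hδ hδ' φ E _ hsum hH
  have hS : Summable fun p => ‖φ p‖ ^ 2 := by
    by_contra hcon
    rw [tsum_eq_zero_of_not_summable hcon] at hsum
    exact zero_ne_one hsum
  have hle1 : ∀ a b, ‖φ (a, b)‖ ≤ 1 := by
    intro a b
    have := hS.le_tsum (a, b) fun _ _ => sq_nonneg _
    rw [hsum] at this
    nlinarith [norm_nonneg (φ (a, b))]
  have h := isEigen_of_Hfl hH
  obtain ⟨⟨k, n⟩, h0, hmax⟩ := exists_forall_norm_le hS hsum
  obtain ⟨m, hm⟩ : ∃ m, n + k ^ 2 = m := ⟨_, rfl⟩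
  have hmax' : ∀ c d, ‖φ (c, d)‖ ≤ ‖φ (k, n)‖ := fun c d => hmax (c, d)
  have he : |E - m| ≤ 1 / 8 :=
    (h.abs_sub_le_of_max hδ hm h0 hmax').trans (by linarith)
  rcases lt_or_ge k.natAbs 50000 with hk | hk
  · left
    rintro ⟨a, b⟩
    obtain ⟨l, d, ⟨hl, hd⟩, hle⟩ := exists_decay (f := fun a b => φ (a, b))
      (Z := fun a b => a.natAbs < 50000 ∧ b + a ^ 2 = m) ⟨k, n, hk, hm⟩ hle1
      (fun _ _ => h.isDominated_of_near hδ hδ'.le he hm h0 hmax' hk) a b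
    exact hle.trans (half_pow_supNorm_le_exp_near he hl hd)
  · right
    have hE := h.abs_sub_le_sq hδ hδ'.le he hm h0 (IsEigen.le_two_pow_of_max hmax') hk
    have hE' : |((m : ℤ) : ℝ) - E| ≤ 2 * δ := by
      rw [abs_sub_comm]
      exact hE.trans (by nlinarith)
    have hn : 4 ≤ |(n : ℝ) - E| := by
      have h1 : (50000 : ℝ) ≤ |(k : ℝ)| := by
        have : (50000 : ℤ) ≤ |k| := by rw [Int.abs_eq_natAbs]; omega
        exact_mod_cast this
      have h2 : (n : ℝ) + (k : ℝ) ^ 2 = m := by exact_mod_cast hm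
      have h3 : (50000 : ℝ) ≤ (k : ℝ) ^ 2 := by rw [← sq_abs]; nlinarith
      rw [le_abs]
      right
      linarith [(abs_le.1 he).1]
    refine ⟨(k, n), (-k, n), ⟨hn, ?_⟩, ⟨hn, ?_⟩, ?_⟩
    · rw [hm]; exact hE'
    · rw [neg_sq, hm]; exact hE'
    rintro ⟨a, b⟩
    obtain ⟨c, d, ⟨hc, rfl⟩, hle⟩ := exists_decay (f := fun a b => φ (a, b))
      (Z := fun a b => a.natAbs = k.natAbs ∧ b = n) ⟨k, n, rfl, rfl⟩ hle1
      (fun _ _ => h.isDominated_of_far hδ hδ'.le he hm h0 hmax' hk) a b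
    have hC : 1 ≤ Real.exp ((50000 + 50000 ^ 2 + 2) / 4) := Real.one_le_exp (by norm_num)
    refine (hle.trans (half_pow_supNorm_le_exp_dist1 a b c d)).trans ?_
    refine le_trans ?_ (le_mul_of_one_le_left (by positivity) hC)
    rcases Int.natAbs_eq_natAbs_iff.1 hc with rfl | rfl
    · exact le_add_of_nonneg_right (Real.exp_pos _).le
    · exact le_add_of_nonneg_left (Real.exp_pos _).le
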